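/- For integrable random variables X and Y and β ∈ (0,1), CVaR is subadditive: φ_β(X + Y) ≤ φ_β(X) + φ_β(Y), where φ_β(X) = inf_{α ∈ ℝ} (α + (1/(1-β)) E[max(X - α, 0)]). -/

import Mathlib

open MeasureTheory

/-- The Rockafellar–Uryasev upper conditional value-at-risk at level `β`. -/
noncomputable def cvar {Ω : Type*} [MeasurableSpace Ω] (μ : Measure Ω) (β : ℝ)
    (X : Ω → ℝ) : ℝ :=
  ⨅ α : ℝ, α + (1 - β)⁻¹ * ∫ ω, max (X ω - α) 0 ∂μ

theorem stmt2 {Ω : Type*} [MeasurableSpace Ω] (μ : Measure Ω) [IsProbabilityMeasure μ]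
    (X Y : Ω → ℝ) (hX : Integrable X μ) (hY : Integrable Y μ)
    (β : ℝ) (hβ : β ∈ Set.Ioo (0 : ℝ) 1) :
    cvar μ β (fun ω => X ω + Y ω) ≤ cvar μ β X + cvar μ β Y := by
  have hβ1 : 0 < 1 - β := by linarith [hβ.2]
  have hc : 1 ≤ (1 - β)⁻¹ := (one_le_inv₀ hβ1).2 (by linarith [hβ.1])
  have hint : ∀ (Z : Ω → ℝ), Integrable Z μ → ∀ α : ℝ,
      Integrable (fun ω => max (Z ω - α) 0) μ := fun Z hZ α =>
    (hZ.sub (integrable_const α)).pos_part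
  have hbdd : BddBelow (Set.range fun α : ℝ =>
      α + (1 - β)⁻¹ * ∫ ω, max ((X ω + Y ω) - α) 0 ∂μ) := by
    refine ⟨∫ ω, (X ω + Y ω) ∂μ, ?_⟩
    rintro _ ⟨α, rfl⟩
    have hZ : Integrable (fun ω => X ω + Y ω) μ := hX.add hY
    have h0 : 0 ≤ ∫ ω, max ((X ω + Y ω) - α) 0 ∂μ :=
      integral_nonneg fun ω => le_max_right _ _
    have h1 : ∫ ω, ((X ω + Y ω) - α) ∂μ ≤ ∫ ω, max ((X ω + Y ω) - α) 0 ∂μ :=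
      integral_mono (hZ.sub (integrable_const α)) (hint _ hZ α) fun ω => le_max_left _ _
    rw [integral_sub hZ (integrable_const α)] at h1
    simp only [integral_const, probReal_univ, one_smul] at h1
    have h2 := le_mul_of_one_le_left h0 hc
    show _ ≤ α + _
    linarith
  unfold cvar
  refine le_ciInf_add_ciInf fun a b => ?_
  refine (ciInf_le hbdd (a + b)).trans ?_
  have h3 : ∫ ω, max ((X ω + Y ω) - (a + b)) 0 ∂μ ≤
      ∫ ω, max (X ω - a) 0 ∂μ + ∫ ω, max (Y ω - b) 0 ∂μ := by
    rw [← integral_add (hint X hX a) (hint Y hY b)]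
    refine integral_mono (hint _ (hX.add hY) (a + b)) ((hint X hX a).add (hint Y hY b)) ?_
    intro ω
    have e1 := le_max_left (X ω - a) 0
    have e2 := le_max_left (Y ω - b) 0
    have e3 := le_max_right (X ω - a) 0
    have e4 := le_max_right (Y ω - b) 0
    exact max_le (by show _ ≤ max (X ω - a) 0 + max (Y ω - b) 0; linarith)
      (by show _ ≤ max (X ω - a) 0 + max (Y ω - b) 0; linarith)
  have h4 := mul_le_mul_of_nonneg_left h3 (by linarith : 0 ≤ (1 - β)⁻¹)
  rw [mul_add] at h4
  linarith
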